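/- arXiv:1907.01594 — 3 statements merged into one kernel-verified Lean document; each statement's English description precedes it below -/
import Mathlib

section
/- For a fixed complex 2×2 matrix W, every entry of the matrix-valued function Z ↦ (Z−W)⁻¹ / det(Z−W), defined where det(Z−W) ≠ 0, is annihilated by □ = ∂²/∂z₁₁∂z₂₂ − ∂²/∂z₁₂∂z₂₁. -/
noncomputable section

/-- The space of 2×2 complex matrices, as functions of indices. -/
abbrev M2 : Type := Fin 2 → Fin 2 → ℂ

/-- The elementary matrix with a 1 in position (i,j). -/
def eM (i j : Fin 2) : M2 := fun a b => if a = i ∧ b = j then (1 : ℂ) else 0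

/-- The partial derivative ∂/∂z_{ij}. -/
noncomputable def pd (i j : Fin 2) (f : M2 → ℂ) : M2 → ℂ :=
  fun Z => fderiv ℂ f Z (eM i j)

/-- The determinant N(Z) = z₁₁z₂₂ − z₁₂z₂₁. -/
def detM (Z : M2) : ℂ := Z 0 0 * Z 1 1 - Z 0 1 * Z 1 0

theorem pd_coord (W : M2) (i j a b : Fin 2) (Z : M2) :
    pd i j (fun Y => Y a b - W a b) Z = eM i j a b := by
  have h : HasFDerivAt (fun Y : M2 => Y a b - W a b)
      ((ContinuousLinearMap.proj (R := ℂ) (φ := fun _ : Fin 2 => ℂ) b).comp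
        (ContinuousLinearMap.proj (R := ℂ) (φ := fun _ : Fin 2 => Fin 2 → ℂ) a)) Z :=
    (ContinuousLinearMap.hasFDerivAt
      ((ContinuousLinearMap.proj (R := ℂ) (φ := fun _ : Fin 2 => ℂ) b).comp
        (ContinuousLinearMap.proj (R := ℂ) (φ := fun _ : Fin 2 => Fin 2 → ℂ) a))).sub_const (W a b)
  rw [pd, h.fderiv]
  rfl

theorem pd_sub (i j : Fin 2) {f g : M2 → ℂ} {Z : M2}
    (hf : DifferentiableAt ℂ f Z) (hg : DifferentiableAt ℂ g Z) :
    pd i j (fun Y => f Y - g Y) Z = pd i j f Z - pd i j g Z := by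
  simp [pd, fderiv_fun_sub hf hg]

theorem pd_mul (i j : Fin 2) {f g : M2 → ℂ} {Z : M2}
    (hf : DifferentiableAt ℂ f Z) (hg : DifferentiableAt ℂ g Z) :
    pd i j (fun Y => f Y * g Y) Z = pd i j f Z * g Z + f Z * pd i j g Z := by
  simp [pd, fderiv_fun_mul hf hg]
  ring

theorem pd_const_mul (i j : Fin 2) (c : ℂ) {f : M2 → ℂ} {Z : M2}
    (hf : DifferentiableAt ℂ f Z) :
    pd i j (fun Y => c * f Y) Z = c * pd i j f Z := by
  simp [pd, fderiv_const_mul hf]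

theorem pd_div_pow (i j : Fin 2) (n : ℕ) {f g : M2 → ℂ} {Z : M2}
    (hf : DifferentiableAt ℂ f Z) (hg : DifferentiableAt ℂ g Z) (h0 : g Z ≠ 0) :
    pd i j (fun Y => f Y / g Y ^ n) Z =
      (pd i j f Z * g Z - n * f Z * pd i j g Z) / g Z ^ (n + 1) := by
  have h := hf.hasFDerivAt.mul
    (((hasDerivAt_pow n (g Z)).inv (pow_ne_zero n h0)).comp_hasFDerivAt Z hg.hasFDerivAt)
  have h' : pd i j (fun Y => f Y / g Y ^ n) Z = _ := congrArg (fun L => L (eM i j)) h.fderiv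
  rw [h']
  rcases n with _ | n
  · simp [pd]
    field_simp
  · simp [pd]
    field_simp
    ring

theorem pd_congr (i j : Fin 2) {f g : M2 → ℂ} {Z : M2} (h : f =ᶠ[nhds Z] g) :
    pd i j f Z = pd i j g Z := by
  rw [pd, pd, h.fderiv_eq]

theorem differentiable_detM_sub (W : M2) :
    Differentiable ℂ fun Y : M2 => detM (fun a b => Y a b - W a b) := by
  unfold detM
  fun_prop

theorem pd_detM_sub (W : M2) (i j : Fin 2) (Z : M2) :
    pd i j (fun Y => detM (fun a b => Y a b - W a b)) Z =
      eM i j 0 0 * (Z 1 1 - W 1 1) + (Z 0 0 - W 0 0) * eM i j 1 1 -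
        (eM i j 0 1 * (Z 1 0 - W 1 0) + (Z 0 1 - W 0 1) * eM i j 1 0) := by
  unfold detM
  rw [pd_sub, pd_mul, pd_mul]
  · simp only [pd_coord]
  all_goals fun_prop

theorem pd_pd_coord_div_detM_sq (W Z : M2) (h : detM (fun a b => Z a b - W a b) ≠ 0)
    (c s : ℂ) (a b i j k l p q : Fin 2)
    (hs : ∀ Y, pd k l (fun Y => detM (fun a b => Y a b - W a b)) Y = s * (Y p q - W p q)) :
    pd i j (pd k l fun Y => c * (Y a b - W a b) / detM (fun a b => Y a b - W a b) ^ 2) Z =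
      ((c * eM k l a b * pd i j (fun Y => detM (fun a b => Y a b - W a b)) Z -
          2 * c * s * (eM i j a b * (Z p q - W p q) + (Z a b - W a b) * eM i j p q)) *
          detM (fun a b => Z a b - W a b) -
        3 * (c * eM k l a b * detM (fun a b => Z a b - W a b) -
          2 * c * s * ((Z a b - W a b) * (Z p q - W p q))) *
          pd i j (fun Y => detM (fun a b => Y a b - W a b)) Z) /
        detM (fun a b => Z a b - W a b) ^ 4 := by
  have hd := differentiable_detM_sub W
  have hfst : (pd k l fun Y => c * (Y a b - W a b) / detM (fun a b => Y a b - W a b) ^ 2) =ᶠ[nhds Z]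
      fun Y => (c * eM k l a b * detM (fun a b => Y a b - W a b) -
        2 * c * s * ((Y a b - W a b) * (Y p q - W p q))) /
        detM (fun a b => Y a b - W a b) ^ 3 := by
    filter_upwards [hd.continuous.continuousAt.eventually_ne h] with Y hY
    rw [pd_div_pow k l 2 (by fun_prop) (hd Y) hY, pd_const_mul k l c (by fun_prop), pd_coord, hs]
    push_cast
    ring
  have hN := (hd Z).const_mul (c * eM k l a b)
  have hQ : DifferentiableAt ℂ
      (fun Y : M2 => 2 * c * s * ((Y a b - W a b) * (Y p q - W p q))) Z := by fun_prop
  rw [pd_congr i j hfst, pd_div_pow i j 3 (hN.fun_sub hQ) (hd Z) h,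
    pd_sub i j hN hQ, pd_const_mul i j _ (hd Z),
    pd_const_mul i j _ (by fun_prop), pd_mul i j (by fun_prop) (by fun_prop), pd_coord, pd_coord]
  norm_num

theorem box_coord_div_detM_sq (W Z : M2) (h : detM (fun a b => Z a b - W a b) ≠ 0)
    (c : ℂ) (a b : Fin 2) :
    pd 0 0 (pd 1 1 fun Y => c * (Y a b - W a b) / detM (fun a b => Y a b - W a b) ^ 2) Z -
      pd 0 1 (pd 1 0 fun Y => c * (Y a b - W a b) / detM (fun a b => Y a b - W a b) ^ 2) Z = 0 := by
  rw [pd_pd_coord_div_detM_sq W Z h c 1 a b 0 0 1 1 0 0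
      (fun Y => by rw [pd_detM_sub]; simp [eM]),
    pd_pd_coord_div_detM_sq W Z h c (-1) a b 0 1 1 0 0 1
      (fun Y => by rw [pd_detM_sub]; simp [eM]),
    pd_detM_sub, pd_detM_sub, ← sub_div, div_eq_zero_iff]
  left
  fin_cases a <;> fin_cases b <;> simp [eM, detM] <;> ring

theorem inv_apply_div_detM (A : M2) (i j : Fin 2) :
    (Matrix.of A)⁻¹ i j / detM A = (Matrix.of A).adjugate i j / detM A ^ 2 := by
  rw [Matrix.inv_def, Matrix.det_fin_two, Matrix.smul_apply, Ring.inverse_eq_inv']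
  simp only [Matrix.of_apply, detM, smul_eq_mul]
  rw [div_eq_mul_inv, div_eq_mul_inv, sq, mul_inv]
  ring

/-- every entry of Z ↦ (Z−W)⁻¹/det(Z−W) is annihilated by
□ = ∂²/∂z₁₁∂z₂₂ − ∂²/∂z₁₂∂z₂₁ wherever det(Z−W) ≠ 0. -/
theorem stmt1 (W Z : M2) (h : detM (fun a b => Z a b - W a b) ≠ 0) (i j : Fin 2) :
    pd 0 0 (pd 1 1 (fun Y =>
        (Matrix.of fun a b => Y a b - W a b)⁻¹ i j / detM (fun a b => Y a b - W a b))) Z -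
      pd 0 1 (pd 1 0 (fun Y =>
        (Matrix.of fun a b => Y a b - W a b)⁻¹ i j / detM (fun a b => Y a b - W a b))) Z = 0 := by
  simp only [show ∀ Y : M2, (Matrix.of fun a b => Y a b - W a b)⁻¹ i j /
      detM (fun a b => Y a b - W a b) = _ from
    fun Y => inv_apply_div_detM (fun a b => Y a b - W a b) i j, Matrix.adjugate_fin_two]
  fin_cases i <;> fin_cases j
  · simpa using box_coord_div_detM_sq W Z h 1 1 1
  · simpa using box_coord_div_detM_sq W Z h (-1) 0 1
  · simpa using box_coord_div_detM_sq W Z h (-1) 1 0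
  · simpa using box_coord_div_detM_sq W Z h 1 0 0
end
end

section
/- A function f belonging to the algebra ℂ[z₁₁,z₁₂,z₂₁,z₂₂, N⁻¹] (polynomials in the four matrix entries and the inverse determinant N⁻¹, defined on the set N ≠ 0) satisfies □(□f) = 0 if and only if there exist harmonic elements h₀ and h₁ of this algebra (i.e., □h₀ = □h₁ = 0) such that f = h₀ + N·h₁, where N = z₁₁z₂₂ − z₁₂z₂₁ and □ = 4(∂₁₁∂₂₂ − ∂₁₂∂₂₁). -/
noncomputable section

/-- The operator □ = 4(∂₁₁∂₂₂ − ∂₁₂∂₂₁). -/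
noncomputable def box (f : M2 → ℂ) : M2 → ℂ :=
  fun Z => 4 * (pd 0 0 (pd 1 1 f) Z - pd 0 1 (pd 1 0 f) Z)

/-- Membership in the algebra ℂ[z₁₁,z₁₂,z₂₁,z₂₂,N⁻¹] of functions on {N ≠ 0}: f agrees on
{N ≠ 0} with a polynomial expression in the four matrix entries and N⁻¹. -/
def InLaurent (f : M2 → ℂ) : Prop :=
  ∃ P : MvPolynomial (Fin 5) ℂ, ∀ Z : M2, detM Z ≠ 0 →
    f Z = MvPolynomial.eval (fun i => ![Z 0 0, Z 0 1, Z 1 0, Z 1 1, (detM Z)⁻¹] i) P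

open MvPolynomial

lemma pderiv_pderiv_comm {σ R : Type*} [CommRing R] (i j : σ) (P : MvPolynomial σ R) :
    pderiv i (pderiv j P) = pderiv j (pderiv i P) := by
  classical
  have h : ⁅(pderiv i : Derivation R _ (MvPolynomial σ R)), pderiv j⁆ = 0 :=
    derivation_ext fun k => by
      rw [Derivation.commutator_apply, pderiv_X, pderiv_X, ← pderiv_X]
      simp only [pderiv_X, Pi.single_apply]
      split_ifs <;> simp
  have := congrArg (fun D => D P) h
  simpa [Derivation.commutator_apply, sub_eq_zero] using this

/-- Polynomials in the entries of a 2×2 matrix. -/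
abbrev MatPoly : Type := MvPolynomial (Fin 2 × Fin 2) ℂ

namespace MatPoly

/-- The determinant polynomial `N`. -/
def det : MatPoly := X (0, 0) * X (1, 1) - X (0, 1) * X (1, 0)

/-- The Euler operator `∑ zᵢⱼ ∂ᵢⱼ`. -/
def euler : Module.End ℂ MatPoly :=
  ∑ p, LinearMap.mulLeft ℂ (X p : MatPoly) ∘ₗ (pderiv p).toLinearMap

/-- The operator `□` on polynomials. -/
def lap : Module.End ℂ MatPoly :=
  (4 : ℂ) • ((pderiv (0, 0)).toLinearMap ∘ₗ (pderiv (1, 1)).toLinearMap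
    - (pderiv (0, 1)).toLinearMap ∘ₗ (pderiv (1, 0)).toLinearMap)

/-- The operator `P ↦ N ^ (m + 1) * □ (N ^ (-m) * P)` on polynomials. -/
def twistedLap (m : ℕ) : Module.End ℂ MatPoly :=
  LinearMap.mulLeft ℂ det ∘ₗ lap - (4 * m : ℂ) • (euler + (1 - m : ℂ) • LinearMap.id)

lemma C_ofNat (n : ℕ) [n.AtLeastTwo] : (C (ofNat(n) : ℂ) : MatPoly) = ofNat(n) :=
  map_ofNat C n

lemma pderiv_ofNat (p : Fin 2 × Fin 2) (n : ℕ) [n.AtLeastTwo] :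
    pderiv p (ofNat(n) : MatPoly) = 0 := by
  rw [← C_ofNat, pderiv_C]

lemma euler_apply (P : MatPoly) : euler P =
    X (0, 0) * pderiv (0, 0) P + X (0, 1) * pderiv (0, 1) P
      + X (1, 0) * pderiv (1, 0) P + X (1, 1) * pderiv (1, 1) P := by
  simp [euler, Fintype.sum_prod_type, add_assoc]

lemma lap_apply (P : MatPoly) : lap P =
    4 * (pderiv (0, 0) (pderiv (1, 1) P) - pderiv (0, 1) (pderiv (1, 0) P)) := by
  simp [lap, smul_eq_C_mul, C_ofNat]

lemma twistedLap_apply (m : ℕ) (P : MatPoly) : twistedLap m P =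
    det * lap P - 4 * m * (euler P + (1 - m) * P) := by
  simp only [twistedLap, smul_eq_C_mul, LinearMap.sub_apply, LinearMap.comp_apply,
    LinearMap.mulLeft_apply, LinearMap.smul_apply, LinearMap.add_apply, LinearMap.id_apply,
    map_mul, map_sub, map_natCast, C_ofNat, map_one]

lemma euler_det_mul (P : MatPoly) : euler (det * P) = det * (euler P + 2 * P) := by
  simp [euler_apply, det, pderiv_X]
  ring

lemma lap_det_mul (P : MatPoly) : lap (det * P) = det * lap P + 4 * (euler P + 2 * P) := by
  simp [euler_apply, lap_apply, det, pderiv_X]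
  ring

lemma lap_euler (P : MatPoly) : lap (euler P) = euler (lap P) + 2 * lap P := by
  simp [euler_apply, lap_apply, pderiv_X, pderiv_ofNat,
    pderiv_pderiv_comm (R := ℂ) ((0, 1) : Fin 2 × Fin 2) (0, 0),
    pderiv_pderiv_comm (R := ℂ) ((1, 0) : Fin 2 × Fin 2) (0, 0),
    pderiv_pderiv_comm (R := ℂ) ((1, 1) : Fin 2 × Fin 2) (0, 0),
    pderiv_pderiv_comm (R := ℂ) ((1, 0) : Fin 2 × Fin 2) (0, 1),
    pderiv_pderiv_comm (R := ℂ) ((1, 1) : Fin 2 × Fin 2) (0, 1),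
    pderiv_pderiv_comm (R := ℂ) ((1, 1) : Fin 2 × Fin 2) (1, 0)]
  ring

lemma twistedLap_euler (m : ℕ) (P : MatPoly) :
    twistedLap m (euler P) = euler (twistedLap m P) := by
  have h : ∀ c : ℂ, ∀ Q : MatPoly, euler (C c * Q) = C c * euler Q := fun c Q => by
    simp [← smul_eq_C_mul]
  have h1 := h (4 * (m : ℂ)) (euler P + C (1 - (m : ℂ)) * P)
  rw [map_add, h (1 - (m : ℂ))] at h1
  simp only [map_mul, map_sub, map_natCast, C_ofNat, map_one] at h1
  simp only [twistedLap_apply, map_sub, h1, euler_det_mul, lap_euler]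

lemma twistedLap_comm (m k : ℕ) (P : MatPoly) :
    twistedLap m (twistedLap k P) = twistedLap k (twistedLap m P) := by
  have h : ∀ j : ℕ, ∀ Q : MatPoly, twistedLap j Q =
      twistedLap 0 Q - (4 * j : ℂ) • (euler Q + (1 - j : ℂ) • Q) := fun j Q => by
    simp [twistedLap]
  rw [h m P, h k P, h m, h k]
  simp only [map_sub, map_add, map_smul, twistedLap_euler]
  module

lemma euler_of_isHomogeneous {d : ℕ} {P : MatPoly} (h : P.IsHomogeneous d) :
    euler P = (d : ℂ) • P := by
  have := h.sum_X_mul_pderiv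
  simpa [euler, Nat.cast_smul_eq_nsmul] using this

lemma isHomogeneous_lap {d : ℕ} {P : MatPoly} (h : P.IsHomogeneous (d + 2)) :
    (lap P).IsHomogeneous d := by
  rw [lap_apply, ← C_ofNat 4]
  exact ((h.pderiv.pderiv).sub (h.pderiv.pderiv)).C_mul _

/-- In total degree zero, the kernel of `□²` is that of `□`. -/
lemma twistedLap_eq_zero_of_sq {m : ℕ} {P : MatPoly} (hP : P.IsHomogeneous (2 * m))
    (h : twistedLap m (twistedLap m P) = 0) : twistedLap m P = 0 := by
  have key : ∀ {m : ℕ} {P : MatPoly}, euler P = (2 * m : ℂ) • P →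
      twistedLap m P = det * lap P - 4 * m * (m + 1) * P := fun {m P} h => by
    rw [twistedLap_apply, h, smul_eq_C_mul]
    simp only [map_mul, map_natCast, C_ofNat]
    ring
  have hE : ∀ {m : ℕ} {P : MatPoly}, P.IsHomogeneous (2 * m) → euler P = (2 * m : ℂ) • P :=
    fun h => by simpa using euler_of_isHomogeneous h
  have hT : ∀ {m : ℕ} {P : MatPoly}, euler P = (2 * m : ℂ) • P →
      euler (twistedLap m P) = (2 * m : ℂ) • twistedLap m P := fun h => by
    rw [← twistedLap_euler, h, map_smul]
  induction m generalizing P with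
  | zero =>
    have : P = C (coeff 0 P) := totalDegree_eq_zero_iff_eq_C.1
      ((totalDegree_zero_iff_isHomogeneous _).2 (by simpa using hP))
    rw [this]
    simp [twistedLap_apply, lap_apply]
  | succ m ih =>
    have hQ : (lap P).IsHomogeneous (2 * m) := isHomogeneous_lap hP
    have comm : ∀ {P : MatPoly}, euler P = (2 * ((m + 1 : ℕ) : ℂ)) • P →
        lap (twistedLap (m + 1) P) = twistedLap m (lap P) := fun {P} h => by
      have h2 := lap_euler P
      have h3 : lap (C (4 * ((m + 1 : ℕ) : ℂ) * (((m + 1 : ℕ) : ℂ) + 1)) * P)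
        = C (4 * ((m + 1 : ℕ) : ℂ) * (((m + 1 : ℕ) : ℂ) + 1)) * lap P := by
        simp only [← smul_eq_C_mul, map_smul]
      have h4 : euler (lap P) = (2 * m : ℂ) • lap P := by
        rw [h, map_smul] at h2
        rw [← sub_eq_iff_eq_add.2 h2]
        simp only [smul_eq_C_mul, map_mul, map_natCast, C_ofNat]
        push_cast
        ring
      rw [key h, key h4, map_sub, lap_det_mul, h4]
      simp only [map_mul, map_natCast, C_ofNat, map_add, map_one] at h3
      rw [h3, smul_eq_C_mul]
      simp only [map_mul, map_natCast, C_ofNat]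
      push_cast
      ring
    have h1 : twistedLap m (lap P) = 0 := by
      refine ih hQ ?_
      rw [← comm (hE hP), ← comm (hT (hE hP)), h, map_zero]
    rw [← comm (hE hP)] at h1
    rw [key (hT (hE hP)), h1] at h
    have h5 : (4 * ((m + 1 : ℕ) : MatPoly) * (((m + 1 : ℕ) : MatPoly) + 1)) ≠ 0 := by
      exact_mod_cast (by positivity : 4 * (m + 1) * ((m + 1) + 1) ≠ 0)
    rwa [mul_zero, zero_sub, neg_eq_zero, mul_eq_zero, or_iff_right h5] at h

lemma exists_decomposition_of_isHomogeneous {m d : ℕ} {P : MatPoly} (hP : P.IsHomogeneous d)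
    (h : twistedLap (m + 1) (twistedLap m P) = 0) :
    ∃ A B : MatPoly, P = A + B ∧ twistedLap m A = 0 ∧ twistedLap (m + 1) B = 0 := by
  have diff : ∀ Q : MatPoly, euler Q = (d : ℂ) • Q →
      twistedLap m Q = twistedLap (m + 1) Q + (4 * (d - 2 * m) : ℂ) • Q := fun Q hQ => by
    rw [twistedLap, twistedLap]
    simp only [LinearMap.sub_apply, LinearMap.smul_apply, LinearMap.add_apply,
      LinearMap.id_apply, hQ]
    push_cast
    module
  have hE := euler_of_isHomogeneous hP
  have hT : euler (twistedLap m P) = (d : ℂ) • twistedLap m P := by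
    rw [← twistedLap_euler, hE, map_smul]
  have hd := diff _ hT
  rw [h, zero_add] at hd
  by_cases hdm : d = 2 * m
  · subst hdm
    refine ⟨P, 0, by simp, twistedLap_eq_zero_of_sq hP ?_, by simp⟩
    rw [hd]; simp
  · have hc : (4 * (d - 2 * m) : ℂ) ≠ 0 := by
      refine mul_ne_zero (by norm_num) (sub_ne_zero.2 ?_)
      exact_mod_cast hdm
    refine ⟨P - (4 * (d - 2 * m) : ℂ)⁻¹ • twistedLap m P,
      (4 * (d - 2 * m) : ℂ)⁻¹ • twistedLap m P, by simp, ?_, by simp [h]⟩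
    rw [map_sub, map_smul, hd, inv_smul_smul₀ hc, sub_self]

lemma exists_decomposition {m : ℕ} {P : MatPoly}
    (h : twistedLap (m + 1) (twistedLap m P) = 0) :
    ∃ A B : MatPoly, P = A + B ∧ twistedLap m A = 0 ∧ twistedLap (m + 1) B = 0 := by
  have hc : ∀ d ∈ Finset.range (P.totalDegree + 1),
      twistedLap (m + 1) (twistedLap m (homogeneousComponent d P)) = 0 := by
    have hind := (Module.End.eigenspaces_iSupIndep euler).comp (Nat.cast_injective (R := ℂ))
    refine (iSupIndep_iff_finsetSum_eq_zero_imp_eq_zero _).1 hind _ _ (fun d hd => ?_) ?_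
    · rw [Function.comp_apply, Module.End.mem_eigenspace_iff, ← twistedLap_euler,
        ← twistedLap_euler,
        euler_of_isHomogeneous (homogeneousComponent_isHomogeneous d P), map_smul, map_smul]
    · rw [← map_sum, ← map_sum, sum_homogeneousComponent, h]
  have := fun d hd => exists_decomposition_of_isHomogeneous
    (homogeneousComponent_isHomogeneous d P) (hc d hd)
  choose! A B hAB hA hB using this
  refine ⟨∑ d ∈ Finset.range (P.totalDegree + 1), A d,
    ∑ d ∈ Finset.range (P.totalDegree + 1), B d, ?_, ?_, ?_⟩
  · rw [← Finset.sum_add_distrib, ← Finset.sum_congr rfl hAB, sum_homogeneousComponent]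
  · rw [map_sum, Finset.sum_eq_zero hA]
  · rw [map_sum, Finset.sum_eq_zero hB]
/-- The function `P / N ^ m` on matrices. -/
def toFun (m : ℕ) (P : MatPoly) (Z : M2) : ℂ := eval (fun p => Z p.1 p.2) P / detM Z ^ m

lemma eval_det (Z : M2) : eval (fun p => Z p.1 p.2) det = detM Z := by
  simp [det, detM]

lemma isOpen_detM_ne_zero : IsOpen {Z : M2 | detM Z ≠ 0} := by
  refine isOpen_ne_fun ?_ continuous_const
  unfold detM
  fun_prop

lemma eq_zero_of_toFun_eq_zero {m : ℕ} {P : MatPoly}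
    (h : ∀ Z, detM Z ≠ 0 → toFun m P Z = 0) : P = 0 := by
  have h1 : det * P = 0 := by
    refine MvPolynomial.funext fun x => ?_
    have hx := eval_det fun i j => x (i, j)
    by_cases h0 : detM (fun i j => x (i, j)) = 0
    · simp_all
    · simpa [toFun, h0] using Or.inr (h _ h0)
  have h2 : det ≠ 0 := fun h0 => by
    have := eval_det fun i j => if i = j then 1 else 0
    simp [h0, detM] at this
  exact (mul_eq_zero.1 h1).resolve_left h2

lemma hasFDerivAt_eval (P : MatPoly) (Z : M2) :
    HasFDerivAt (fun Z : M2 => eval (fun p => Z p.1 p.2) P)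
      (∑ p : Fin 2 × Fin 2, eval (fun p => Z p.1 p.2) (pderiv p P) •
        ((ContinuousLinearMap.proj p.2 : (Fin 2 → ℂ) →L[ℂ] ℂ).comp
          (ContinuousLinearMap.proj p.1 : M2 →L[ℂ] Fin 2 → ℂ))) Z := by
  induction P using MvPolynomial.induction_on with
  | C a =>
    simp only [eval_C]
    refine (hasFDerivAt_const a Z).congr_fderiv ?_
    ext v
    simp
  | add P Q hP hQ =>
    simp only [map_add]
    refine (hP.fun_add hQ).congr_fderiv ?_
    ext v
    simp [add_mul, Finset.sum_add_distrib]
  | mul_X P q hP =>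
    have hX : HasFDerivAt (fun Z : M2 => Z q.1 q.2)
        ((ContinuousLinearMap.proj q.2 : (Fin 2 → ℂ) →L[ℂ] ℂ).comp
          (ContinuousLinearMap.proj q.1 : M2 →L[ℂ] Fin 2 → ℂ)) Z :=
      ((ContinuousLinearMap.proj q.2 : (Fin 2 → ℂ) →L[ℂ] ℂ).comp
        (ContinuousLinearMap.proj q.1 : M2 →L[ℂ] Fin 2 → ℂ)).hasFDerivAt
    simp only [map_mul, eval_X]
    refine (hP.fun_mul hX).congr_fderiv ?_
    ext v
    simp only [Derivation.leibniz, smul_eq_mul, map_add, map_mul, eval_X, pderiv_X,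
      add_apply, smul_apply, sum_apply, ContinuousLinearMap.comp_apply,
      ContinuousLinearMap.proj_apply, add_mul, Finset.sum_add_distrib, mul_assoc, Finset.mul_sum]
    congr 1
    rw [Finset.sum_eq_single q (fun p _ hp => by simp [hp.symm]) (by simp)]
    simp

lemma fderiv_eval_eM (P : MatPoly) (Z : M2) (i j : Fin 2) :
    fderiv ℂ (fun Z : M2 => eval (fun p => Z p.1 p.2) P) Z (eM i j) =
      eval (fun p => Z p.1 p.2) (pderiv (i, j) P) := by
  rw [(hasFDerivAt_eval P Z).fderiv]
  simp only [sum_apply, smul_apply,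
    ContinuousLinearMap.comp_apply, ContinuousLinearMap.proj_apply, smul_eq_mul]
  rw [Finset.sum_eq_single (i, j) (fun p _ hp => ?_) (by simp)]
  · simp [eM]
  · rw [eM, if_neg fun h => hp (Prod.ext h.1 h.2), mul_zero]

lemma pd_eq_toFun {f : M2 → ℂ} {m : ℕ} {P : MatPoly}
    (hf : ∀ Z, detM Z ≠ 0 → f Z = toFun m P Z) (i j : Fin 2) (Z : M2) (hZ : detM Z ≠ 0) :
    pd i j f Z = toFun (m + 1) (det * pderiv (i, j) P - m * P * pderiv (i, j) det) Z := by
  have hev : f =ᶠ[nhds Z] toFun m P :=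
    Filter.eventuallyEq_of_mem (isOpen_detM_ne_zero.mem_nhds hZ) hf
  have hD : (detM : M2 → ℂ) = fun Z => eval (fun p => Z p.1 p.2) det :=
    _root_.funext fun Z => (eval_det Z).symm
  have hd : DifferentiableAt ℂ detM Z := hD ▸ (hasFDerivAt_eval det Z).differentiableAt
  have hde : fderiv ℂ detM Z (eM i j) = eval (fun p => Z p.1 p.2) (pderiv (i, j) det) := by
    rw [hD, fderiv_eval_eM]
  have hP := (hasFDerivAt_eval P Z).differentiableAt
  have hmul : toFun m P = fun Z => eval (fun p => Z p.1 p.2) P * (detM Z ^ m)⁻¹ :=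
    _root_.funext fun Z => div_eq_mul_inv _ _
  have hi : HasFDerivAt (fun Z => (detM Z ^ m)⁻¹)
      ((-(m * detM Z ^ (m - 1)) / (detM Z ^ m) ^ 2) • fderiv ℂ detM Z) Z :=
    ((hasDerivAt_pow m (detM Z)).fun_inv (pow_ne_zero m hZ)).comp_hasFDerivAt Z hd.hasFDerivAt
  rw [pd, hev.fderiv_eq, hmul, (hP.hasFDerivAt.fun_mul hi).fderiv]
  simp only [add_apply, smul_apply, smul_eq_mul, hde,
    fderiv_eval_eM, toFun, map_sub, map_mul, map_natCast, eval_det]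
  rcases m with _ | m
  · field_simp
    simp
  · simp only [Nat.add_sub_cancel]
    field_simp
    ring

lemma box_eq_toFun {f : M2 → ℂ} {m : ℕ} {P : MatPoly}
    (hf : ∀ Z, detM Z ≠ 0 → f Z = toFun m P Z) (Z : M2) (hZ : detM Z ≠ 0) :
    box f Z = toFun (m + 1) (twistedLap m P) Z := by
  have key : 4 * ((det * pderiv (0, 0) (det * pderiv (1, 1) P - (m : MatPoly) * P * pderiv (1, 1) det)
        - ((m + 1 : ℕ) : MatPoly) * (det * pderiv (1, 1) P - (m : MatPoly) * P * pderiv (1, 1) det) * pderiv (0, 0) det)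
      - (det * pderiv (0, 1) (det * pderiv (1, 0) P - (m : MatPoly) * P * pderiv (1, 0) det)
        - ((m + 1 : ℕ) : MatPoly) * (det * pderiv (1, 0) P - (m : MatPoly) * P * pderiv (1, 0) det) * pderiv (0, 1) det))
      = det * twistedLap m P := by
    simp [twistedLap_apply, euler_apply, lap_apply, det, pderiv_X]
    ring
  have key' := congrArg (eval fun p : Fin 2 × Fin 2 => Z p.1 p.2) key
  rw [map_mul, map_sub, map_mul _ det (twistedLap m P), eval_det, map_ofNat] at key'
  rw [box, pd_eq_toFun (pd_eq_toFun hf 1 1) 0 0 Z hZ, pd_eq_toFun (pd_eq_toFun hf 1 0) 0 1 Z hZ,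
    toFun, toFun, ← sub_div, ← mul_div_assoc, key', toFun]
  field_simp
  ring

lemma exists_eq_toFun_of_inLaurent {f : M2 → ℂ} (hf : InLaurent f) :
    ∃ (m : ℕ) (P : MatPoly), ∀ Z, detM Z ≠ 0 → f Z = toFun m P Z := by
  obtain ⟨Q, hQ⟩ := hf
  suffices h : ∃ (m : ℕ) (P : MatPoly), ∀ Z, detM Z ≠ 0 →
      eval (fun i => ![Z 0 0, Z 0 1, Z 1 0, Z 1 1, (detM Z)⁻¹] i) Q = toFun m P Z by
    obtain ⟨m, P, h⟩ := h
    exact ⟨m, P, fun Z hZ => (hQ Z hZ).trans (h Z hZ)⟩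
  clear hQ
  induction Q using MvPolynomial.induction_on with
  | C a => exact ⟨0, C a, fun Z _ => by simp [toFun]⟩
  | add Q₁ Q₂ h₁ h₂ =>
    obtain ⟨m₁, P₁, h₁⟩ := h₁
    obtain ⟨m₂, P₂, h₂⟩ := h₂
    refine ⟨m₁ + m₂, P₁ * det ^ m₂ + P₂ * det ^ m₁, fun Z hZ => ?_⟩
    rw [map_add, h₁ Z hZ, h₂ Z hZ]
    simp only [toFun, map_add, map_mul, map_pow, eval_det]
    field_simp
    ring
  | mul_X Q i h =>
    obtain ⟨m, P, h⟩ := h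
    have hX : ∀ p : Fin 2 × Fin 2, ∃ (m' : ℕ) (P' : MatPoly), ∀ Z, detM Z ≠ 0 →
        toFun m P Z * Z p.1 p.2 = toFun m' P' Z := fun p =>
      ⟨m, P * X p, fun Z _ => by simp [toFun, div_mul_eq_mul_div]⟩
    have hN : ∃ (m' : ℕ) (P' : MatPoly), ∀ Z, detM Z ≠ 0 →
        toFun m P Z * (detM Z)⁻¹ = toFun m' P' Z :=
      ⟨m + 1, P, fun Z hZ => by
        simp only [toFun]
        field_simp
        ring⟩
    have hi : ∃ (m' : ℕ) (P' : MatPoly), ∀ Z, detM Z ≠ 0 →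
        toFun m P Z * ![Z 0 0, Z 0 1, Z 1 0, Z 1 1, (detM Z)⁻¹] i = toFun m' P' Z := by
      fin_cases i
      exacts [hX (0, 0), hX (0, 1), hX (1, 0), hX (1, 1), hN]
    obtain ⟨m', P', h'⟩ := hi
    exact ⟨m', P', fun Z hZ => by rw [map_mul, eval_X, h Z hZ, h' Z hZ]⟩

lemma inLaurent_toFun (m : ℕ) (P : MatPoly) : InLaurent (toFun m P) := by
  refine ⟨rename (fun p => ![![0, 1], ![2, 3]] p.1 p.2) P * X 4 ^ m, fun Z _ => ?_⟩
  rw [map_mul, eval_rename, map_pow, eval_X, toFun, div_eq_mul_inv, ← inv_pow]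
  congr 3
  ext ⟨i, j⟩
  fin_cases i <;> fin_cases j <;> rfl

lemma toFun_mul_det_pow (m k : ℕ) (P : MatPoly) (Z : M2) (hZ : detM Z ≠ 0) :
    toFun (m + k) (P * det ^ k) Z = toFun m P Z := by
  simp only [toFun, map_mul, map_pow, eval_det]
  field_simp
  ring

lemma toFun_add (m : ℕ) (P Q : MatPoly) (Z : M2) (hZ : detM Z ≠ 0) :
    toFun m (P + Q) Z = toFun m P Z + detM Z * toFun (m + 1) Q Z := by
  simp only [toFun, map_add]
  field_simp
  ring

lemma box_box_eq_zero_iff {f : M2 → ℂ} {m : ℕ} {P : MatPoly}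
    (hf : ∀ Z, detM Z ≠ 0 → f Z = toFun m P Z) :
    (∀ Z, detM Z ≠ 0 → box (box f) Z = 0) ↔ twistedLap (m + 1) (twistedLap m P) = 0 := by
  have h := box_eq_toFun (box_eq_toFun hf)
  exact ⟨fun h0 => eq_zero_of_toFun_eq_zero fun Z hZ => (h Z hZ).symm.trans (h0 Z hZ),
    fun h0 Z hZ => by simp [h Z hZ, h0, toFun]⟩

lemma box_eq_zero_iff {f : M2 → ℂ} {m : ℕ} {P : MatPoly}
    (hf : ∀ Z, detM Z ≠ 0 → f Z = toFun m P Z) :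
    (∀ Z, detM Z ≠ 0 → box f Z = 0) ↔ twistedLap m P = 0 := by
  have h := box_eq_toFun hf
  exact ⟨fun h0 => eq_zero_of_toFun_eq_zero fun Z hZ => (h Z hZ).symm.trans (h0 Z hZ),
    fun h0 Z hZ => by simp [h Z hZ, h0, toFun]⟩

end MatPoly

/-- an element f of ℂ[z₁₁,z₁₂,z₂₁,z₂₂,N⁻¹] is biharmonic (□²f = 0 on {N ≠ 0})
iff f = h₀ + N·h₁ on {N ≠ 0} with h₀, h₁ harmonic elements of the same algebra. -/
theorem stmt7 (f : M2 → ℂ) (hf : InLaurent f) :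
    (∀ Z : M2, detM Z ≠ 0 → box (box f) Z = 0) ↔
    ∃ h0 h1 : M2 → ℂ, InLaurent h0 ∧ InLaurent h1 ∧
      (∀ Z : M2, detM Z ≠ 0 → box h0 Z = 0) ∧
      (∀ Z : M2, detM Z ≠ 0 → box h1 Z = 0) ∧
      (∀ Z : M2, detM Z ≠ 0 → f Z = h0 Z + detM Z * h1 Z) := by
  constructor
  · intro h
    obtain ⟨m, P, hP⟩ := MatPoly.exists_eq_toFun_of_inLaurent hf
    obtain ⟨A, B, rfl, hA, hB⟩ :=
      MatPoly.exists_decomposition ((MatPoly.box_box_eq_zero_iff hP).1 h)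
    exact ⟨_, _, MatPoly.inLaurent_toFun m A, MatPoly.inLaurent_toFun (m + 1) B,
      (MatPoly.box_eq_zero_iff fun _ _ => rfl).2 hA,
      (MatPoly.box_eq_zero_iff fun _ _ => rfl).2 hB,
      fun Z hZ => (hP Z hZ).trans (MatPoly.toFun_add m A B Z hZ)⟩
  · rintro ⟨h0, h1, hL0, hL1, hb0, hb1, hfh⟩
    obtain ⟨m, A, hA⟩ := MatPoly.exists_eq_toFun_of_inLaurent hL0
    obtain ⟨k, B, hB⟩ := MatPoly.exists_eq_toFun_of_inLaurent hL1
    have hA' : ∀ Z, detM Z ≠ 0 → h0 Z = MatPoly.toFun (m + k) (A * MatPoly.det ^ k) Z :=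
      fun Z hZ => by rw [hA Z hZ, MatPoly.toFun_mul_det_pow m k A Z hZ]
    have hB' : ∀ Z, detM Z ≠ 0 →
        h1 Z = MatPoly.toFun (m + k + 1) (B * MatPoly.det ^ (m + 1)) Z := fun Z hZ => by
      rw [hB Z hZ, ← MatPoly.toFun_mul_det_pow k (m + 1) B Z hZ, add_left_comm, add_assoc]
    refine (MatPoly.box_box_eq_zero_iff (m := m + k)
      (P := A * MatPoly.det ^ k + B * MatPoly.det ^ (m + 1)) fun Z hZ => ?_).2 ?_
    · rw [hfh Z hZ, hA' Z hZ, hB' Z hZ, MatPoly.toFun_add _ _ _ Z hZ]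
    · rw [map_add, (MatPoly.box_eq_zero_iff hA').1 hb0, zero_add, MatPoly.twistedLap_comm,
        (MatPoly.box_eq_zero_iff hB').1 hb1, map_zero]
end
end

section
/- Let F_d be a C³ function on an open cone in ℂ⁴ ∖ {0} (coordinates z₁₁,z₁₂,z₂₁,z₂₂) with values in 2×2 complex matrices, homogeneous of degree d ≠ −1 and harmonic (□F_d = 0 entrywise, □ = 4(∂₁₁∂₂₂ − ∂₁₂∂₂₁)). Define F = F_d + (N/(d+1))·(∂F_d∂)⁺, where N = z₁₁z₂₂ − z₁₂z₂₁, ∂F_d∂ is the matrix ∂ applied on both sides of F_d, and (·)⁺ is the adjugate. Then Mx F = 0 and Tr(∂(□F)) = 0, where Mx F = 4(∂F∂ − ∂∂⁺F⁺). -/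
noncomputable section

/-- Matrix-valued functions, given by their entry functions. -/
abbrev MF : Type := Fin 2 → Fin 2 → M2 → ℂ

/-- Entry (i,j) of the operator matrix ∂ = [[∂₁₁, ∂₂₁],[∂₁₂, ∂₂₂]]. -/
noncomputable def delE (i j : Fin 2) (f : M2 → ℂ) : M2 → ℂ := pd j i f

/-- Entry (i,j) of the operator matrix ∂⁺ = [[∂₂₂, −∂₂₁],[−∂₁₂, ∂₁₁]]. -/
noncomputable def delPE (i j : Fin 2) (f : M2 → ℂ) : M2 → ℂ :=
  fun Z => (-1 : ℂ) ^ ((i : ℕ) + (j : ℕ)) * pd (1 - i) (1 - j) f Z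

/-- Apply an operator matrix on the left of a matrix of functions (formal matrix product). -/
noncomputable def opL (D : Fin 2 → Fin 2 → (M2 → ℂ) → M2 → ℂ) (F : MF) : MF :=
  fun i j Z => ∑ k, D i k (F k j) Z

/-- Apply an operator matrix on the right of a matrix of functions (formal matrix product). -/
noncomputable def opR (F : MF) (D : Fin 2 → Fin 2 → (M2 → ℂ) → M2 → ℂ) : MF :=
  fun i j Z => ∑ k, D k j (F i k) Z

/-- The adjugate F⁺ = [[F₂₂, −F₁₂],[−F₂₁, F₁₁]] of a matrix of functions. -/
def adjF (F : MF) : MF :=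
  fun i j Z => (-1 : ℂ) ^ ((i : ℕ) + (j : ℕ)) * F (1 - j) (1 - i) Z

/-- The Maxwell operator Mx F = 4(∂F∂ − ∂∂⁺F⁺). -/
noncomputable def Mx (F : MF) : MF :=
  fun i j Z => 4 * (opR (opL delE F) delE i j Z - opL delE (opL delPE (adjF F)) i j Z)

section Holomorphic

open Metric MeasureTheory Filter Topology

variable {E : Type*} [NormedAddCommGroup E] [NormedSpace ℂ E] [FiniteDimensional ℂ E]

/-- Directional derivatives of a holomorphic function of several variables are holomorphic. -/
theorem differentiableOn_fderiv_apply {U : Set E} (hU : IsOpen U) {f : E → ℂ}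
    (hf : DifferentiableOn ℂ f U) (v : E) : DifferentiableOn ℂ (fun z => fderiv ℂ f z v) U := by
  intro z₀ hz₀
  refine DifferentiableAt.differentiableWithinAt ?_
  have hnear : ∀ᶠ z in 𝓝 z₀, z ∈ U ∧ dist (f z) (f z₀) < 1 :=
    (hU.eventually_mem hz₀).and ((hf.differentiableAt (hU.mem_nhds hz₀)).continuousAt.eventually
      (ball_mem_nhds _ one_pos))
  obtain ⟨δ, hδ, hball⟩ := Metric.eventually_nhds_iff_ball.mp hnear
  obtain ⟨r, hr, hrv⟩ : ∃ r : ℝ, 0 < r ∧ r * ‖v‖ < δ / 3 := by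
    refine ⟨δ / (3 * (‖v‖ + 1)), by positivity, ?_⟩
    have : 0 ≤ ‖v‖ := norm_nonneg v
    rw [div_mul_eq_mul_div, div_lt_div_iff₀ (by positivity) (by positivity)]
    nlinarith
  have hmem : ∀ z ∈ ball z₀ (δ / 3), ∀ t ∈ closedBall (0 : ℂ) r,
      z + t • v ∈ ball z₀ (2 * δ / 3) := by
    intro z hz t ht
    rw [mem_ball, dist_eq_norm] at hz ⊢
    rw [mem_closedBall_zero_iff] at ht
    have h1 : ‖t • v‖ ≤ r * ‖v‖ := by
      rw [norm_smul]
      gcongr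
    calc ‖z + t • v - z₀‖ = ‖(z - z₀) + t • v‖ := by congr 1; abel
      _ ≤ ‖z - z₀‖ + ‖t • v‖ := norm_add_le _ _
      _ < 2 * δ / 3 := by linarith
  have hmemδ : ∀ z ∈ ball z₀ (2 * δ / 3), z ∈ ball z₀ δ := fun z hz =>
    ball_subset_ball (by linarith) hz
  have hdiff : ∀ z ∈ ball z₀ δ, DifferentiableAt ℂ f z := fun z hz =>
    hf.differentiableAt (hU.mem_nhds (hball z hz).1)
  have hbound : ∀ z ∈ ball z₀ (2 * δ / 3), ‖fderiv ℂ f z‖ ≤ 2 / (δ / 3) := by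
    intro z hz
    have hsub : ball z (δ / 3) ⊆ ball z₀ δ := ball_subset_ball' (by
      rw [mem_ball] at hz
      linarith)
    refine Complex.norm_fderiv_le_div_of_mapsTo_ball
      (fun w hw => (hdiff w (hsub hw)).differentiableWithinAt) (fun w hw => ?_) (by positivity)
    have h1 := (hball w (hsub hw)).2
    have h2 := (hball z (hmemδ z hz)).2
    rw [mem_closedBall]
    linarith [dist_triangle_right (f w) (f z) (f z₀)]
  set c : ℝ → ℂ := fun θ => deriv (circleMap 0 r) θ * (1 / circleMap 0 r θ ^ 2) with hc
  have hcircle : ∀ θ, circleMap (0 : ℂ) r θ ∈ closedBall (0 : ℂ) r := fun θ =>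
    circleMap_mem_closedBall _ hr.le _
  have hcircle0 : ∀ θ, circleMap (0 : ℂ) r θ ≠ 0 := fun θ => circleMap_ne_center hr.ne'
  have hc_cont : Continuous c := by
    have h1 : Continuous (circleMap (0 : ℂ) r) := continuous_circleMap 0 r
    simp only [hc, deriv_circleMap]
    exact (h1.mul continuous_const).mul
      (continuous_const.div (h1.pow 2) fun θ => pow_ne_zero 2 (hcircle0 θ))
  have hline : ∀ z ∈ ball z₀ (δ / 3), ∀ t ∈ closedBall (0 : ℂ) r,
      HasDerivAt (fun t : ℂ => f (z + t • v)) (fderiv ℂ f (z + t • v) v) t := by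
    intro z hz t ht
    have h1 : HasDerivAt (fun t : ℂ => z + t • v) v t := by
      simpa using ((hasDerivAt_id t).smul_const v).const_add z
    exact (hdiff _ (hmemδ _ (hmem z hz t ht))).hasFDerivAt.comp_hasDerivAt t h1
  have hcauchy : ∀ z ∈ ball z₀ (δ / 3), fderiv ℂ f z v =
      (2 * Real.pi * Complex.I)⁻¹ *
        ∫ θ in (0 : ℝ)..2 * Real.pi, c θ * f (z + circleMap 0 r θ • v) := by
    intro z hz
    have hd : DifferentiableOn ℂ (fun t : ℂ => f (z + t • v)) (closedBall 0 r) := fun t ht =>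
      (hline z hz t ht).differentiableAt.differentiableWithinAt
    have h0 := (hline z hz 0 (mem_closedBall_self hr.le)).deriv
    have h1 := hd.deriv_eq_smul_circleIntegral hr
    rw [h0] at h1
    simp only [zero_smul, add_zero, smul_eq_mul, sub_zero] at h1
    rw [eq_inv_mul_iff_mul_eq₀ Complex.two_pi_I_ne_zero, ← h1, circleIntegral]
    simp only [hc, smul_eq_mul, mul_assoc]
  have hcont : ∀ z ∈ ball z₀ (δ / 3),
      Continuous fun θ => c θ * f (z + circleMap 0 r θ • v) := by
    intro z hz
    refine hc_cont.mul (continuous_iff_continuousAt.mpr fun θ => ?_)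
    exact ContinuousAt.comp (f := fun θ => z + circleMap 0 r θ • v)
      (hdiff _ (hmemδ _ (hmem z hz _ (hcircle θ)))).continuousAt
      (((continuous_circleMap 0 r).smul continuous_const).const_add z).continuousAt
  have hs : ball z₀ (δ / 3) ∈ 𝓝 z₀ := ball_mem_nhds _ (by positivity)
  have hz₀s : z₀ ∈ ball z₀ (δ / 3) := mem_of_mem_nhds hs
  have hint := intervalIntegral.hasFDerivAt_integral_of_dominated_of_fderiv_le
    (𝕜 := ℂ) (μ := volume) (a := 0) (b := 2 * Real.pi) (s := ball z₀ (δ / 3)) (x₀ := z₀)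
    (F := fun z θ => c θ * f (z + circleMap 0 r θ • v))
    (F' := fun z θ => c θ • fderiv ℂ f (z + circleMap 0 r θ • v))
    (bound := fun θ => ‖c θ‖ * (2 / (δ / 3))) hs
    (eventually_of_mem hs fun z hz => (hcont z hz).aestronglyMeasurable)
    ((hcont z₀ hz₀s).intervalIntegrable _ _)
    (by
      let _ : MeasurableSpace E := borel E
      have : BorelSpace E := ⟨rfl⟩
      have : ProperSpace (E →L[ℂ] ℂ) := FiniteDimensional.proper ℂ _
      have : ProperSpace E := FiniteDimensional.proper ℂ _
      refine hc_cont.aestronglyMeasurable.smul (Measurable.aestronglyMeasurable ?_)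
      exact (measurable_fderiv ℂ f).comp
        (((continuous_circleMap 0 r).smul continuous_const).const_add z₀).measurable)
    (Eventually.of_forall fun θ _ z hz => by
      rw [norm_smul]
      exact mul_le_mul_of_nonneg_left (hbound _ (hmem z hz _ (hcircle θ))) (norm_nonneg _))
    ((hc_cont.norm.mul continuous_const).intervalIntegrable _ _)
    (Eventually.of_forall fun θ _ z hz => by
      have h1 : HasFDerivAt f _ (z + circleMap 0 r θ • v) :=
        (hdiff _ (hmemδ _ (hmem z hz _ (hcircle θ)))).hasFDerivAt
      have h2 := h1.comp z ((hasFDerivAt_id z).add_const (circleMap 0 r θ • v))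
      exact h2.const_mul (c θ))
  exact (hint.differentiableAt.const_mul _).congr_of_eventuallyEq
    (eventually_of_mem hs hcauchy)

theorem differentiableOn_fderiv {U : Set E} (hU : IsOpen U) {f : E → ℂ}
    (hf : DifferentiableOn ℂ f U) : DifferentiableOn ℂ (fderiv ℂ f) U := by
  let b := Module.finBasis ℂ E
  have hsum : fderiv ℂ f =
      fun z => ∑ i, fderiv ℂ f z (b i) • LinearMap.toContinuousLinearMap (b.coord i) := by
    funext z
    ext w
    conv_lhs => rw [← b.sum_repr w, map_sum]
    simp [mul_comm]
  rw [hsum]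
  exact DifferentiableOn.fun_sum fun i _ =>
    (differentiableOn_fderiv_apply hU hf (b i)).smul_const _

theorem fderiv_fderiv_apply_comm {U : Set E} (hU : IsOpen U) {f : E → ℂ}
    (hf : DifferentiableOn ℂ f U) {z : E} (hz : z ∈ U) (v w : E) :
    fderiv ℂ (fun y => fderiv ℂ f y v) z w = fderiv ℂ (fun y => fderiv ℂ f y w) z v := by
  have hd : HasFDerivAt (fderiv ℂ f) (fderiv ℂ (fderiv ℂ f) z) z :=
    ((differentiableOn_fderiv hU hf).differentiableAt (hU.mem_nhds hz)).hasFDerivAt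
  have happly : ∀ u, fderiv ℂ (fun y => fderiv ℂ f y u) z =
      (fderiv ℂ (fderiv ℂ f) z).flip u := fun u => by
    rw [(hd.clm_apply (hasFDerivAt_const u z)).fderiv]
    ext
    simp
  rw [happly, happly]
  exact second_derivative_symmetric_of_eventually
    ((hU.eventually_mem hz).mono fun y hy => (hf.differentiableAt (hU.mem_nhds hy)).hasFDerivAt)
    hd w v

end Holomorphic

section FormalOperators

variable {R : Type*} [CommRing R] [Algebra ℂ R] (D : Fin 2 → Fin 2 → Derivation ℂ R R)

/-- The operator `□` built from four derivations of an algebra. -/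
def derivBox (f : R) : R := 4 * (D 0 0 (D 1 1 f) - D 0 1 (D 1 0 f))

/-- The matrix `∂A∂` built from four derivations of an algebra. -/
def derivSandwich (A : Fin 2 → Fin 2 → R) (i j : Fin 2) : R :=
  ∑ k, D j k (∑ l, D l i (A l k))

/-- The matrix `∂∂⁺A` built from four derivations of an algebra. -/
def derivSquare (A : Fin 2 → Fin 2 → R) (i j : Fin 2) : R :=
  ∑ k, D k i (∑ l : Fin 2, (-1) ^ ((k : ℕ) + (l : ℕ)) * D (1 - k) (1 - l) (A l j))

/-- The adjugate of a `2 × 2` matrix. -/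
def adj₂ (A : Fin 2 → Fin 2 → R) (i j : Fin 2) : R :=
  (-1) ^ ((i : ℕ) + (j : ℕ)) * A (1 - j) (1 - i)

/-- The determinant of a `2 × 2` matrix. -/
def det₂ (A : Fin 2 → Fin 2 → R) : R := A 0 0 * A 1 1 - A 0 1 * A 1 0

/-- The Euler operator built from four derivations of an algebra. -/
def derivEuler (z : Fin 2 → Fin 2 → R) (f : R) : R := ∑ p, ∑ q, z p q * D p q f

variable {D}

theorem derivBox_add (f g : R) : derivBox D (f + g) = derivBox D f + derivBox D g := by
  simp only [derivBox, map_add]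
  ring

theorem derivBox_smul (c : ℂ) (f : R) : derivBox D (c • f) = c • derivBox D f := by
  simp only [derivBox, Derivation.map_smul, mul_sub, smul_sub, mul_smul_comm]

theorem derivEuler_add (z : Fin 2 → Fin 2 → R) (f g : R) :
    derivEuler D z (f + g) = derivEuler D z f + derivEuler D z g := by
  simp only [derivEuler, map_add, mul_add, Finset.sum_add_distrib]

theorem derivEuler_smul (z : Fin 2 → Fin 2 → R) (c : ℂ) (f : R) :
    derivEuler D z (c • f) = c • derivEuler D z f := by
  simp only [derivEuler, Derivation.map_smul, mul_smul_comm, Finset.smul_sum]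

theorem derivSandwich_add (A B : Fin 2 → Fin 2 → R) (i j : Fin 2) :
    derivSandwich D (fun a b => A a b + B a b) i j =
      derivSandwich D A i j + derivSandwich D B i j := by
  simp only [derivSandwich, Fin.sum_univ_two, map_add]
  ring

theorem derivSandwich_smul (c : ℂ) (A : Fin 2 → Fin 2 → R) (i j : Fin 2) :
    derivSandwich D (fun a b => c • A a b) i j = c • derivSandwich D A i j := by
  simp only [derivSandwich, Fin.sum_univ_two, map_add, Derivation.map_smul, smul_add]

omit [Algebra ℂ R] in
theorem adj₂_adj₂ (A : Fin 2 → Fin 2 → R) (i j : Fin 2) : adj₂ (adj₂ A) i j = A i j := by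
  fin_cases i <;> fin_cases j <;> simp [adj₂]

section Commuting

variable (hcomm : ∀ i j k l f, D i j (D k l f) = D k l (D i j f))

include hcomm

theorem four_mul_derivSquare (A : Fin 2 → Fin 2 → R) (i j : Fin 2) :
    4 * derivSquare D A i j = derivBox D (A i j) := by
  fin_cases i <;> simp [derivSquare, derivBox, hcomm 1 1 0 0, hcomm 1 0 0 1, hcomm 1 0 0 0, hcomm 1 1 0 1] <;> ring

theorem derivBox_deriv (i j : Fin 2) (f : R) :
    derivBox D (D i j f) = D i j (derivBox D f) := by
  have h4 : D i j (4 : R) = 0 := by exact_mod_cast (D i j).map_natCast 4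
  simp only [derivBox, Derivation.leibniz, map_sub, h4, smul_eq_mul]
  rw [hcomm 1 1 i j, hcomm 0 0 i j, hcomm 1 0 i j, hcomm 0 1 i j]
  ring

variable {A : Fin 2 → Fin 2 → R} (hA : ∀ a b, derivBox D (A a b) = 0)

include hA

theorem derivBox_sandwich (i j : Fin 2) : derivBox D (derivSandwich D A i j) = 0 := by
  simp only [derivSandwich, Fin.sum_univ_two, map_add, derivBox_add, derivBox_deriv hcomm, hA,
    map_zero, add_zero]

omit hcomm in
theorem deriv_deriv_harmonic (a b : Fin 2) : D 0 0 (D 1 1 (A a b)) = D 0 1 (D 1 0 (A a b)) := by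
  have h := hA a b
  rw [derivBox] at h
  have h4 : (algebraMap ℂ R (1 / 4)) * 4 = 1 := by
    rw [← map_ofNat (algebraMap ℂ R) 4, ← map_mul]
    norm_num
  linear_combination algebraMap ℂ R (1 / 4) * h -
    (D 0 0 (D 1 1 (A a b)) - D 0 1 (D 1 0 (A a b))) * h4

theorem deriv_deriv_deriv_harmonic (i j a b : Fin 2) :
    D 0 0 (D 1 1 (D i j (A a b))) = D 0 1 (D 1 0 (D i j (A a b))) := by
  rw [hcomm 1 1 i j, hcomm 0 0 i j, deriv_deriv_harmonic hA, hcomm 1 0 i j, hcomm 0 1 i j]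

theorem sum_deriv_adj₂_sandwich_left (i k : Fin 2) :
    ∑ l, D l i (adj₂ (derivSandwich D A) l k) = 0 := by
  fin_cases i <;> fin_cases k <;>
    simp [adj₂, derivSandwich, hcomm 1 1 0 0, hcomm 0 1 0 0, hcomm 1 0 0 0, hcomm 0 1 1 1,
      hcomm 1 0 1 1, hcomm 1 0 0 1, deriv_deriv_harmonic hA,
      deriv_deriv_deriv_harmonic hcomm hA] <;> ring

theorem sum_deriv_adj₂_sandwich_right (l j : Fin 2) :
    ∑ k, D j k (adj₂ (derivSandwich D A) l k) = 0 := by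
  fin_cases l <;> fin_cases j <;>
    simp [adj₂, derivSandwich, hcomm 1 1 0 0, hcomm 0 1 0 0, hcomm 1 0 0 0, hcomm 0 1 1 1,
      hcomm 1 0 1 1, hcomm 1 0 0 1, deriv_deriv_harmonic hA,
      deriv_deriv_deriv_harmonic hcomm hA] <;> ring

end Commuting

section Coordinates

variable {z : Fin 2 → Fin 2 → R} (hz : ∀ i j k l, D i j (z k l) = if k = i ∧ l = j then 1 else 0)

include hz

theorem derivBox_det₂_mul (f : R) : derivBox D (det₂ z * f) =
    det₂ z * derivBox D f + 4 * (derivEuler D z f + 2 * f) := by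
  simp [derivBox, derivEuler, det₂, hz]
  ring

theorem derivSandwich_det₂_mul (H : Fin 2 → Fin 2 → R)
    (hl : ∀ i k, ∑ l, D l i (H l k) = 0) (hr : ∀ l j, ∑ k, D j k (H l k) = 0) (i j : Fin 2) :
    derivSandwich D (fun a b => det₂ z * H a b) i j = -adj₂ H i j := by
  have hstep : ∀ k, ∑ l, D l i (det₂ z * H l k) = ∑ l, adj₂ z i l * H l k := by
    intro k
    have h := hl i k
    rw [Fin.sum_univ_two] at h
    fin_cases i <;> simp [det₂, adj₂, hz] at h ⊢ <;> linear_combination (z 0 0 * z 1 1 - z 0 1 * z 1 0) * h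
  simp only [derivSandwich, hstep]
  have h0 := hr 0 j
  have h1 := hr 1 j
  rw [Fin.sum_univ_two] at h0 h1
  fin_cases i
  · fin_cases j <;> simp [adj₂, hz] at h0 h1 ⊢ <;>
      linear_combination z 1 1 * h0 - z 0 1 * h1
  · fin_cases j <;> simp [adj₂, hz] at h0 h1 ⊢ <;>
      linear_combination z 0 0 * h1 - z 1 0 * h0

theorem derivEuler_deriv (hcomm : ∀ i j k l f, D i j (D k l f) = D k l (D i j f))
    {e : ℂ} {f : R} (hf : derivEuler D z f = e • f) (i j : Fin 2) :
    derivEuler D z (D i j f) = (e - 1) • D i j f := by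
  have h := congrArg (D i j) hf
  simp only [derivEuler, Fin.sum_univ_two, map_add, Derivation.leibniz, hz, smul_eq_mul,
    Derivation.map_smul] at h ⊢
  rw [sub_smul, one_smul, ← h, hcomm 0 0 i j, hcomm 0 1 i j, hcomm 1 0 i j, hcomm 1 1 i j]
  fin_cases i <;> fin_cases j <;> simp <;> ring

theorem derivEuler_sandwich (hcomm : ∀ i j k l f, D i j (D k l f) = D k l (D i j f))
    {e : ℂ} {A : Fin 2 → Fin 2 → R} (he : ∀ a b, derivEuler D z (A a b) = e • A a b)
    (i j : Fin 2) :
    derivEuler D z (derivSandwich D A i j) = (e - 2) • derivSandwich D A i j := by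
  have h2 : ∀ p q r s a b, derivEuler D z (D p q (D r s (A a b))) =
      (e - 2) • D p q (D r s (A a b)) := fun p q r s a b => by
    rw [derivEuler_deriv hz hcomm (derivEuler_deriv hz hcomm (he a b) r s) p q]
    congr 1
    ring
  simp only [derivSandwich, Fin.sum_univ_two, map_add, derivEuler_add, h2, smul_add]

section Deformation

variable (hcomm : ∀ i j k l f, D i j (D k l f) = D k l (D i j f)) {e c : ℂ}
  {A F : Fin 2 → Fin 2 → R} (hA : ∀ a b, derivBox D (A a b) = 0)
  (he : ∀ a b, derivEuler D z (A a b) = e • A a b)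
  (hF : ∀ a b, F a b = A a b + c • (det₂ z * adj₂ (derivSandwich D A) a b))

include hcomm hA he hF

theorem derivBox_deformation (a b : Fin 2) :
    derivBox D (F a b) = (4 * c * e) • adj₂ (derivSandwich D A) a b := by
  have hsign : adj₂ (derivSandwich D A) a b =
      ((-1 : ℂ) ^ ((a : ℕ) + (b : ℕ))) • derivSandwich D A (1 - b) (1 - a) := by
    rw [adj₂, Algebra.smul_def, map_pow, map_neg, map_one]
  rw [hF, derivBox_add, hA, zero_add, derivBox_smul, derivBox_det₂_mul hz, hsign, derivBox_smul,
    derivBox_sandwich hcomm hA, derivEuler_smul, derivEuler_sandwich hz hcomm he]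
  simp only [Algebra.smul_def, map_mul, map_sub, map_ofNat]
  ring

theorem maxwell_deformation (hc : c * (e + 1) = 1) (i j : Fin 2) :
    4 * (derivSandwich D F i j - derivSquare D (adj₂ F) i j) = 0 := by
  have hadj : derivBox D (adj₂ F i j) = (4 * c * e) • derivSandwich D A i j := by
    rw [← adj₂_adj₂ (derivSandwich D A), adj₂, adj₂]
    have hsign : ∀ f : R, (-1 : R) ^ ((i : ℕ) + (j : ℕ)) * f =
        ((-1 : ℂ) ^ ((i : ℕ) + (j : ℕ))) • f := fun f => by
      rw [Algebra.smul_def, map_pow, map_neg, map_one]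
    rw [hsign, hsign, derivBox_smul, derivBox_deformation hz hcomm hA he hF, smul_comm]
  have hsand : derivSandwich D F i j = derivSandwich D A i j - c • derivSandwich D A i j := by
    have hF' : F = fun a b => A a b + c • (det₂ z * adj₂ (derivSandwich D A) a b) :=
      funext fun a => funext fun b => hF a b
    rw [hF', derivSandwich_add, derivSandwich_smul,
      derivSandwich_det₂_mul hz _ (sum_deriv_adj₂_sandwich_left hcomm hA)
        (sum_deriv_adj₂_sandwich_right hcomm hA), adj₂_adj₂, smul_neg, sub_eq_add_neg]
  have hc' := congrArg (algebraMap ℂ R) hc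
  rw [mul_sub, four_mul_derivSquare hcomm, hadj, hsand]
  simp only [Algebra.smul_def, map_mul, map_add, map_one, map_ofNat] at hc' ⊢
  linear_combination (-4 * derivSandwich D A i j) * hc'

theorem trace_deriv_box_deformation : ∑ i, ∑ k, D k i (derivBox D (F k i)) = 0 := by
  simp only [derivBox_deformation hz hcomm hA he hF, Derivation.map_smul, ← Finset.smul_sum,
    sum_deriv_adj₂_sandwich_left hcomm hA, Finset.sum_const_zero, smul_zero]

end Deformation

end Coordinates

end FormalOperators

section HolomorphicAlgebra

open TopologicalSpace

/-- The algebra of holomorphic functions on an open set of `2 × 2` matrices. -/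
def holo (U : Opens M2) : Subalgebra ℂ (U → ℂ) where
  carrier := {g | DifferentiableOn ℂ (Function.extend Subtype.val g 0) U}
  mul_mem' {f g} hf hg := (hf.mul hg).congr fun Z hZ => by
    lift Z to U using hZ
    simp only [Pi.mul_apply, Subtype.val_injective.extend_apply]
  add_mem' {f g} hf hg := (hf.add hg).congr fun Z hZ => by
    lift Z to U using hZ
    simp only [Pi.add_apply, Subtype.val_injective.extend_apply]
  algebraMap_mem' c := (differentiableOn_const c).congr fun Z hZ => by
    lift Z to U using hZ
    simp only [Subtype.val_injective.extend_apply, Pi.algebraMap_apply, Algebra.algebraMap_self,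
      RingHom.id_apply]

variable {U : Opens M2}

/-- `r` is the restriction of `f` to `U`. -/
def Represents (r : holo U) (f : M2 → ℂ) : Prop := ∀ Z : U, f Z = r.1 Z

theorem represents_extend (r : holo U) : Represents r (Function.extend Subtype.val r.1 0) :=
  fun Z => Subtype.val_injective.extend_apply _ _ Z

theorem exists_represents {f : M2 → ℂ} (hf : DifferentiableOn ℂ f U) :
    ∃ r : holo U, Represents r f :=
  ⟨⟨fun Z => f Z, hf.congr fun Z hZ => Subtype.val_injective.extend_apply _ _ ⟨Z, hZ⟩⟩,
    fun _ => rfl⟩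

namespace Represents

variable {r s : holo U} {f g : M2 → ℂ}

theorem ext (hr : Represents r f) (hs : Represents s g) (h : ∀ Z ∈ U, f Z = g Z) : r = s :=
  Subtype.ext <| funext fun Z => by rw [← hr, ← hs, h Z Z.2]

theorem eq_of_mem (hr : Represents r f) (hs : Represents s g) (h : r = s) {Z : M2} (hZ : Z ∈ U) :
    f Z = g Z := by
  rw [hr ⟨Z, hZ⟩, hs ⟨Z, hZ⟩, h]

theorem differentiableOn (hr : Represents r f) : DifferentiableOn ℂ f U :=
  r.2.congr fun Z hZ => (hr ⟨Z, hZ⟩).trans (represents_extend r ⟨Z, hZ⟩).symm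

theorem differentiableAt (hr : Represents r f) (Z : U) : DifferentiableAt ℂ f Z :=
  hr.differentiableOn.differentiableAt (U.isOpen.mem_nhds Z.2)

theorem add (hr : Represents r f) (hs : Represents s g) :
    Represents (r + s) (fun Z => f Z + g Z) := fun Z => congrArg₂ (· + ·) (hr Z) (hs Z)

theorem sub (hr : Represents r f) (hs : Represents s g) :
    Represents (r - s) (fun Z => f Z - g Z) := fun Z => congrArg₂ (· - ·) (hr Z) (hs Z)

theorem mul (hr : Represents r f) (hs : Represents s g) :
    Represents (r * s) (fun Z => f Z * g Z) := fun Z => congrArg₂ (· * ·) (hr Z) (hs Z)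

theorem const_smul (c : ℂ) (hr : Represents r f) : Represents (c • r) (fun Z => c * f Z) :=
  fun Z => congrArg (c * ·) (hr Z)

theorem zero : Represents (0 : holo U) (fun _ => 0) := fun _ => rfl

theorem four_mul (hr : Represents r f) : Represents (4 * r) (fun Z => 4 * f Z) :=
  fun Z => congrArg (4 * ·) (hr Z)

theorem neg_one_pow_mul (n : ℕ) (hr : Represents r f) :
    Represents ((-1) ^ n * r) (fun Z => (-1) ^ n * f Z) := fun Z => congrArg ((-1) ^ n * ·) (hr Z)

theorem sum {ι : Type*} [Fintype ι] {r : ι → holo U} {f : ι → M2 → ℂ}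
    (h : ∀ i, Represents (r i) (f i)) : Represents (∑ i, r i) (fun Z => ∑ i, f i Z) := fun Z => by
  simp only [AddSubmonoidClass.coe_finsetSum, Finset.sum_apply]
  exact Finset.sum_congr rfl fun i _ => h i Z

theorem congr (hr : Represents r f) (h : ∀ Z, g Z = f Z) : Represents r g :=
  fun Z => (h Z).trans (hr Z)

theorem pd_eq (hr : Represents r f) (hs : Represents r g) (i j : Fin 2) (Z : U) :
    pd i j f Z = pd i j g Z := by
  have h : f =ᶠ[nhds Z.1] g :=
    (U.isOpen.eventually_mem Z.2).mono fun W hW => hr.eq_of_mem hs rfl hW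
  rw [_root_.pd, _root_.pd, h.fderiv_eq]

end Represents

/-- The partial derivative `∂/∂zᵢⱼ` as a derivation of the algebra of holomorphic functions. -/
def holoDeriv (U : Opens M2) (i j : Fin 2) : Derivation ℂ (holo U) (holo U) :=
  Derivation.mk'
    { toFun := fun r => ⟨fun Z => pd i j (Function.extend Subtype.val r.1 0) Z,
        (differentiableOn_fderiv_apply U.isOpen r.2 (eM i j)).congr fun Z hZ =>
          Subtype.val_injective.extend_apply _ _ ⟨Z, hZ⟩⟩
      map_add' := fun r s => Subtype.ext <| funext fun Z => by
        have hr := represents_extend r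
        have hs := represents_extend s
        change pd i j _ Z = pd i j _ Z + pd i j _ Z
        rw [(represents_extend (r + s)).pd_eq (hr.add hs), pd,
          fderiv_fun_add (hr.differentiableAt Z) (hs.differentiableAt Z)]
        rfl
      map_smul' := fun c r => Subtype.ext <| funext fun Z => by
        have hr := represents_extend r
        change pd i j _ Z = c * pd i j _ Z
        rw [(represents_extend (c • r)).pd_eq (hr.const_smul c), pd,
          fderiv_const_mul (hr.differentiableAt Z)]
        rfl }
    fun r s => Subtype.ext <| funext fun Z => by
      have hr := represents_extend r
      have hs := represents_extend s
      change pd i j _ Z = r.1 Z * pd i j _ Z + s.1 Z * pd i j _ Z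
      rw [(represents_extend (r * s)).pd_eq (hr.mul hs), pd,
        fderiv_fun_mul (hr.differentiableAt Z) (hs.differentiableAt Z), ← hr, ← hs]
      rfl

theorem Represents.pd {r : holo U} {f : M2 → ℂ} (hr : Represents r f) (i j : Fin 2) :
    Represents (holoDeriv U i j r) (pd i j f) := fun Z =>
  hr.pd_eq (represents_extend r) i j Z

theorem holoDeriv_comm (i j k l : Fin 2) (r : holo U) :
    holoDeriv U i j (holoDeriv U k l r) = holoDeriv U k l (holoDeriv U i j r) :=
  (((represents_extend r).pd k l).pd i j).ext (((represents_extend r).pd i j).pd k l)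
    fun _ hZ => fderiv_fderiv_apply_comm U.isOpen r.2 hZ _ _

theorem exists_represents_coord (U : Opens M2) (k l : Fin 2) :
    ∃ r : holo U, Represents r (fun Z => Z k l) :=
  exists_represents (by fun_prop)

theorem holoDeriv_coord {z : Fin 2 → Fin 2 → holo U}
    (hz : ∀ k l, Represents (z k l) (fun Z => Z k l)) (i j k l : Fin 2) :
    holoDeriv U i j (z k l) = if k = i ∧ l = j then 1 else 0 := by
  have hcoord : ∀ Z, pd i j (fun Z => Z k l) Z = if k = i ∧ l = j then 1 else 0 := fun Z => by
    let L : M2 →L[ℂ] ℂ :=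
      (ContinuousLinearMap.proj (R := ℂ) (φ := fun _ : Fin 2 => ℂ) l).comp
        (ContinuousLinearMap.proj (R := ℂ) (φ := fun _ : Fin 2 => Fin 2 → ℂ) k)
    have h : HasFDerivAt (fun Z : M2 => Z k l) L Z := L.hasFDerivAt
    rw [pd, h.fderiv]
    rfl
  refine Subtype.ext <| funext fun Z => ?_
  rw [← (hz k l).pd i j Z, hcoord]
  split_ifs <;> rfl

namespace Represents

theorem box {r : holo U} {f : M2 → ℂ} (hr : Represents r f) :
    Represents (derivBox (holoDeriv U) r) (box f) :=
  (((hr.pd 1 1).pd 0 0).sub ((hr.pd 1 0).pd 0 1)).four_mul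

theorem euler {z : Fin 2 → Fin 2 → holo U} (hz : ∀ k l, Represents (z k l) (fun Z => Z k l))
    {r : holo U} {f : M2 → ℂ} (hr : Represents r f) :
    Represents (derivEuler (holoDeriv U) z r) (fun Z => ∑ p, ∑ q, Z p q * _root_.pd p q f Z) :=
  sum fun p => sum fun q => (hz p q).mul (hr.pd p q)

theorem det {z : Fin 2 → Fin 2 → holo U} (hz : ∀ k l, Represents (z k l) (fun Z => Z k l)) :
    Represents (det₂ z) detM :=
  ((hz 0 0).mul (hz 1 1)).sub ((hz 0 1).mul (hz 1 0))

variable {A : Fin 2 → Fin 2 → holo U} {G : MF} (hA : ∀ a b, Represents (A a b) (G a b))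

include hA

theorem adj (i j : Fin 2) : Represents (adj₂ A i j) (adjF G i j) :=
  (hA (1 - j) (1 - i)).neg_one_pow_mul _

theorem sandwich (i j : Fin 2) :
    Represents (derivSandwich (holoDeriv U) A i j) (opR (opL delE G) delE i j) :=
  sum fun k => (sum fun l => (hA l k).pd l i).pd j k

theorem square (i j : Fin 2) :
    Represents (derivSquare (holoDeriv U) A i j) (opL delE (opL delPE G) i j) :=
  sum fun k => (sum fun l => ((hA l j).pd (1 - k) (1 - l)).neg_one_pow_mul _).pd k i

theorem maxwell (i j : Fin 2) :
    Represents (4 * (derivSandwich (holoDeriv U) A i j - derivSquare (holoDeriv U) (adj₂ A) i j))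
      (Mx G i j) :=
  ((sandwich hA i j).sub (square (adj hA) i j)).four_mul

end Represents

end HolomorphicAlgebra

/-- if F_d is C³ on an open cone U ⊆ ℂ⁴∖{0}, homogeneous of degree d ≠ −1
(in the Euler-operator sense) and harmonic, then F = F_d + (N/(d+1))·(∂F_d∂)⁺ satisfies
Mx F = 0 and Tr(∂(□F)) = 0 on U. -/
theorem stmt8 (U : Set M2) (hU : IsOpen U) (hU0 : (0 : M2) ∉ U)
    (hcone : ∀ Z ∈ U, ∀ t : ℝ, 0 < t → (fun a b => (t : ℂ) * Z a b) ∈ U)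
    (d : ℤ) (hd : d ≠ -1) (Fd : MF)
    (hreg : ∀ a b : Fin 2, ContDiffOn ℂ 3 (Fd a b) U)
    (hhomog : ∀ a b : Fin 2, ∀ Z ∈ U,
        (∑ p : Fin 2, ∑ q : Fin 2, Z p q * pd p q (Fd a b) Z) = (d : ℂ) * Fd a b Z)
    (hharm : ∀ a b : Fin 2, ∀ Z ∈ U, box (Fd a b) Z = 0)
    (F : MF)
    (hFdef : ∀ i j : Fin 2, ∀ Z : M2,
        F i j Z = Fd i j Z + detM Z / ((d : ℂ) + 1) * adjF (opR (opL delE Fd) delE) i j Z) :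
    (∀ i j : Fin 2, ∀ Z ∈ U, Mx F i j Z = 0) ∧
    (∀ Z ∈ U, ∑ i : Fin 2, opL delE (fun a b => box (F a b)) i i Z = 0) := by
  have hd1 : (d : ℂ) + 1 ≠ 0 := by
    intro h
    exact hd (by exact_mod_cast eq_neg_of_add_eq_zero_left h)
  lift U to TopologicalSpace.Opens M2 using hU
  choose A hA using fun a b =>
    exists_represents ((hreg a b).differentiableOn (by norm_num : (3 : WithTop ℕ∞) ≠ 0))
  choose z hz using fun k l => exists_represents_coord U k l
  have hbox : ∀ a b, derivBox (holoDeriv U) (A a b) = 0 := fun a b =>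
    (hA a b).box.ext .zero (hharm a b)
  have heuler : ∀ a b, derivEuler (holoDeriv U) z (A a b) = (d : ℂ) • A a b := fun a b =>
    ((hA a b).euler hz).ext ((hA a b).const_smul _) (hhomog a b)
  let A' : Fin 2 → Fin 2 → holo U := fun a b =>
    A a b + ((d : ℂ) + 1)⁻¹ • (det₂ z * adj₂ (derivSandwich (holoDeriv U) A) a b)
  have hF : ∀ a b, Represents (A' a b) (F a b) := fun a b =>
    ((hA a b).add (((Represents.det hz).mul
      (Represents.adj (Represents.sandwich hA) a b)).const_smul _)).congr fun Z => by
        rw [hFdef]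
        ring
  constructor
  · intro i j Z hZ
    exact (Represents.maxwell hF i j).eq_of_mem .zero
      (maxwell_deformation (holoDeriv_coord hz) holoDeriv_comm hbox heuler (fun _ _ => rfl)
        (inv_mul_cancel₀ hd1) i j) hZ
  · intro Z hZ
    exact (Represents.sum fun i => Represents.sum fun k =>
      (hF k i).box.pd k i).eq_of_mem .zero
        (trace_deriv_box_deformation (holoDeriv_coord hz) holoDeriv_comm hbox heuler
          fun _ _ => rfl) hZ
end
end
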